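/- Let G be a finite simple bipartite graph on n vertices whose cycles are exactly l distinct 4-cycles (l a positive integer), with no cycles of any other length, and such that for every 4-cycle C of G the induced subgraph G∖C obtained by deleting the vertices of C has no edges. Then f(G,x) = 4l·x^{n−4}, where f(G,x) = π(G,x) − φ_p(G,x) with π(G,x) = per(xI − A(G)) and φ_p(G,x) = Σ_{i even} (−1)^{i/2} a_i x^{n−i}. -/

import Mathlib

open Polynomial SimpleGraph
open scoped Classical

noncomputable section

/-- The adjacency matrix of a simple graph `G`, with entries in `R`. -/
def adjMat (R : Type*) [Zero R] [One R] {V : Type*} [Fintype V] (G : SimpleGraph V) :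
    Matrix V V R := fun u v => if G.Adj u v then 1 else 0

/-- The characteristic polynomial `det (xI - A(G))` of a simple graph `G`. -/
def charPolyG (R : Type*) [CommRing R] {V : Type*} [Fintype V] (G : SimpleGraph V) : R[X] :=
  (adjMat R G).charpoly

/-- The permanental polynomial `per (xI - A(G))` of a simple graph `G`. -/
def permPolyG (R : Type*) [CommRing R] {V : Type*} [Fintype V] (G : SimpleGraph V) : R[X] :=
  (Matrix.charmatrix (adjMat R G)).permanent

/-- The modified characteristic polynomial `φ_p(G,x) = ∑_{i even} (-1)^{i/2} a_i x^{n-i}`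
of a (bipartite) graph `G` on `n` vertices, where `a_i` is the coefficient of `x^{n-i}`
in the characteristic polynomial. -/
def phiP {V : Type*} [Fintype V] (G : SimpleGraph V) : ℝ[X] :=
  ∑ i ∈ Finset.range (Fintype.card V + 1),
    if Even i then
      C ((-1 : ℝ) ^ (i / 2) * (charPolyG ℝ G).coeff (Fintype.card V - i)) *
        X ^ (Fintype.card V - i)
    else 0

/-- `G` contains no cycle whose length is divisible by 4. -/
def C4kFree {V : Type*} (G : SimpleGraph V) : Prop :=
  ¬ ∃ (v : V) (c : G.Walk v v), c.IsCycle ∧ 4 ∣ c.length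

/-- `G` is `4k`-intercyclic: it contains no two vertex-disjoint cycles,
each of length divisible by 4. -/
def Intercyclic4k {V : Type*} (G : SimpleGraph V) : Prop :=
  ¬ ∃ (u v : V) (c : G.Walk u u) (d : G.Walk v v),
      c.IsCycle ∧ d.IsCycle ∧ 4 ∣ c.length ∧ 4 ∣ d.length ∧
      ∀ x, x ∈ c.support → x ∉ d.support

/-- A subgraph `R` of `G` is a cycle of `G` if it is the subgraph traced by some cycle walk. -/
def IsCycleSubgraph {V : Type*} (G : SimpleGraph V) (R : G.Subgraph) : Prop :=
  ∃ (v : V) (c : G.Walk v v), c.IsCycle ∧ R = c.toSubgraph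

/-- The set of all `4k`-cycles (cycles of length divisible by 4) of `G`,
viewed as subgraphs. -/
def cycles4k {V : Type*} (G : SimpleGraph V) : Set G.Subgraph :=
  {R | ∃ (v : V) (c : G.Walk v v), c.IsCycle ∧ 4 ∣ c.length ∧ R = c.toSubgraph}

/-- The connected component `c` of the subgraph `H` is a single edge (a `K₂`). -/
def IsEdgeComp {V : Type*} {G : SimpleGraph V} (H : G.Subgraph)
    (c : H.coe.ConnectedComponent) : Prop :=
  ∃ x y : H.verts, H.coe.Adj x y ∧ c.supp = {x, y}

/-- The connected component `c` of the subgraph `H` is a cycle: there is a cycle walk whose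
support is exactly `c` and which uses every edge of `H` inside `c`. -/
def IsCycleComp {V : Type*} {G : SimpleGraph V} (H : G.Subgraph)
    (c : H.coe.ConnectedComponent) : Prop :=
  ∃ (v : H.verts) (w : H.coe.Walk v v), w.IsCycle ∧
    {x | x ∈ w.support} = c.supp ∧
    ∀ x y : H.verts, H.coe.Adj x y → x ∈ c.supp → w.toSubgraph.Adj x y

/-- A Sachs subgraph of `G`: a subgraph each of whose connected components is either
a single edge or a cycle. -/
def IsSachs {V : Type*} {G : SimpleGraph V} (H : G.Subgraph) : Prop :=
  ∀ c : H.coe.ConnectedComponent, IsEdgeComp H c ∨ IsCycleComp H c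

/-- The number of connected components of the subgraph `H`. -/
def pCount {V : Type*} {G : SimpleGraph V} (H : G.Subgraph) : ℕ :=
  Nat.card H.coe.ConnectedComponent

/-- The number of components of `H` that are cycles of length divisible by 4. -/
def sCount {V : Type*} {G : SimpleGraph V} (H : G.Subgraph) : ℕ :=
  Set.ncard {c : H.coe.ConnectedComponent | IsCycleComp H c ∧ c.supp.ncard % 4 = 0}

/-- The number of components of `H` that are cycles of length congruent to 2 mod 4. -/
def tCount {V : Type*} {G : SimpleGraph V} (H : G.Subgraph) : ℕ :=
  Set.ncard {c : H.coe.ConnectedComponent | IsCycleComp H c ∧ c.supp.ncard % 4 = 2}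

/-- The number of components of `H` that are cycles. -/
def cycCount {V : Type*} {G : SimpleGraph V} (H : G.Subgraph) : ℕ :=
  Set.ncard {c : H.coe.ConnectedComponent | IsCycleComp H c}

/-- `R` is a union of connected components of `H`. -/
def IsComponentUnion {V : Type*} {G : SimpleGraph V} (R H : G.Subgraph) : Prop :=
  R ≤ H ∧ ∀ x y, H.Adj x y → x ∈ R.verts → R.Adj x y


/-- A permutation is adapted to `G` when it moves every non-fixed vertex along an edge. -/
def IsAdapted {V : Type*} (G : SimpleGraph V) (σ : Equiv.Perm V) : Prop :=
  ∀ u, σ u ≠ u → G.Adj (σ u) u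

theorem prod_charmatrix_adjMat {V : Type*} [Fintype V] (G : SimpleGraph V)
    (σ : Equiv.Perm V) :
    ∏ i, (adjMat ℝ G).charmatrix (σ i) i =
      if IsAdapted G σ then
        C ((-1 : ℝ) ^ σ.support.card) * X ^ (Fintype.card V - σ.support.card)
      else 0 := by
  split_ifs with h
  · rw [← Finset.prod_mul_prod_compl σ.support]
    congr 1
    · rw [Finset.prod_congr rfl (g := fun _ => (C (-1 : ℝ)))]
      · simp
      · intro i hi
        have hi := Equiv.Perm.mem_support.1 hi
        simp [Matrix.charmatrix_apply_ne _ _ _ hi, adjMat, h i hi]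
    · rw [Finset.prod_congr rfl (g := fun _ => (X : ℝ[X]))]
      · simp [Finset.card_compl]
      · intro i hi
        have hi : σ i = i := by simpa using hi
        rw [hi, Matrix.charmatrix_apply_eq]
        simp [adjMat]
  · simp only [IsAdapted, not_forall] at h
    obtain ⟨i, hi, hadj⟩ := h
    apply Finset.prod_eq_zero (Finset.mem_univ i)
    simp [Matrix.charmatrix_apply_ne _ _ _ hi, adjMat, hadj]

/-- The linear map on polynomials that takes `charPolyG ℝ G` to `phiP G`,
where `n` is the number of vertices. -/
def evenTwist (n : ℕ) : ℝ[X] →ₗ[ℝ] ℝ[X] where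
  toFun p := ∑ i ∈ Finset.range (n + 1),
    if Even i then C ((-1 : ℝ) ^ (i / 2) * p.coeff (n - i)) * X ^ (n - i) else 0
  map_add' p q := by
    rw [← Finset.sum_add_distrib]
    refine Finset.sum_congr rfl fun i _ => ?_
    split_ifs <;> simp; ring
  map_smul' c p := by
    rw [Finset.smul_sum]
    refine Finset.sum_congr rfl fun i _ => ?_
    split_ifs
    · simp [smul_eq_C_mul]; ring
    · simp

theorem evenTwist_C_mul_X_pow {n k : ℕ} (hk : k ≤ n) (he : Even k) (c : ℝ) :
    evenTwist n (C c * X ^ (n - k)) = C ((-1 : ℝ) ^ (k / 2) * c) * X ^ (n - k) := by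
  change ∑ i ∈ Finset.range (n + 1), _ = _
  rw [Finset.sum_eq_single k]
  · simp [he]
  · intro i hi hik
    have hi : i < n + 1 := Finset.mem_range.1 hi
    have : n - i ≠ n - k := by omega
    simp [coeff_X_pow, this]
  · intro h
    exact absurd (Finset.mem_range.2 (by omega)) h

theorem phiP_eq_evenTwist {V : Type*} [Fintype V] (G : SimpleGraph V) :
    phiP G = evenTwist (Fintype.card V) (charPolyG ℝ G) := rfl

theorem even_card_support_of_sq_eq_one {V : Type*} [Fintype V] {σ : Equiv.Perm V}
    (h : σ ^ 2 = 1) : Even σ.support.card :=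
  even_iff_two_dvd.2 (Equiv.Perm.two_dvd_card_support h)

theorem sign_of_sq_eq_one {V : Type*} [Fintype V] {σ : Equiv.Perm V} (h : σ ^ 2 = 1) :
    Equiv.Perm.sign σ = (-1) ^ (σ.support.card / 2) := by
  have h2 : σ.cycleType = Multiset.replicate σ.cycleType.card 2 :=
    Multiset.eq_replicate.2 ⟨rfl, Equiv.Perm.pow_prime_eq_one_iff.1 h⟩
  have h3 := σ.sum_cycleType
  rw [h2, Multiset.sum_replicate, smul_eq_mul] at h3
  rw [Equiv.Perm.sign_of_cycleType, σ.sum_cycleType, ← h3, pow_add,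
    Nat.mul_div_cancel _ two_pos, pow_mul']
  simp

/-- `σ` is the cyclic permutation `a ↦ b ↦ c ↦ d ↦ a` of four distinct vertices that form a
4-cycle of `G`, and fixes all other vertices. -/
structure IsQuad {V : Type*} (G : SimpleGraph V) (σ : Equiv.Perm V) (a b c d : V) : Prop where
  hac : a ≠ c
  hbd : b ≠ d
  hab : G.Adj a b
  hbc : G.Adj b c
  hcd : G.Adj c d
  hda : G.Adj d a
  σa : σ a = b
  σb : σ b = c
  σc : σ c = d
  σd : σ d = a
  fix : ∀ x, x ≠ a → x ≠ b → x ≠ c → x ≠ d → σ x = x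

namespace IsQuad

variable {V : Type*} {G : SimpleGraph V} {σ : Equiv.Perm V} {a b c d : V}

theorem isAdapted (h : IsQuad G σ a b c d) : IsAdapted G σ := by
  intro u hu
  by_cases ha : u = a
  · rw [ha, h.σa]; exact h.hab.symm
  by_cases hb : u = b
  · rw [hb, h.σb]; exact h.hbc.symm
  by_cases hc : u = c
  · rw [hc, h.σc]; exact h.hcd.symm
  by_cases hd : u = d
  · rw [hd, h.σd]; exact h.hda.symm
  exact absurd (h.fix u ha hb hc hd) hu

theorem sq_ne_one (h : IsQuad G σ a b c d) : σ ^ 2 ≠ 1 := by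
  intro h2
  have := congrArg (fun τ : Equiv.Perm V => τ a) h2
  simp [pow_two, h.σa, h.σb] at this
  exact h.hac this.symm

theorem symm (h : IsQuad G σ a b c d) : IsQuad G σ⁻¹ a d c b where
  hac := h.hac
  hbd := h.hbd.symm
  hab := h.hda.symm
  hbc := h.hcd.symm
  hcd := h.hbc.symm
  hda := h.hab.symm
  σa := by rw [Equiv.Perm.inv_eq_iff_eq, h.σd]
  σb := by rw [Equiv.Perm.inv_eq_iff_eq, h.σc]
  σc := by rw [Equiv.Perm.inv_eq_iff_eq, h.σb]
  σd := by rw [Equiv.Perm.inv_eq_iff_eq, h.σa]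
  fix x ha hd hc hb := by rw [Equiv.Perm.inv_eq_iff_eq, h.fix x ha hb hc hd]

theorem eq {τ : Equiv.Perm V} (h : IsQuad G σ a b c d) (h' : IsQuad G τ a b c d) : σ = τ := by
  ext x
  by_cases ha : x = a
  · rw [ha, h.σa, h'.σa]
  by_cases hb : x = b
  · rw [hb, h.σb, h'.σb]
  by_cases hc : x = c
  · rw [hc, h.σc, h'.σc]
  by_cases hd : x = d
  · rw [hd, h.σd, h'.σd]
  rw [h.fix x ha hb hc hd, h'.fix x ha hb hc hd]

theorem card_support [Fintype V] (h : IsQuad G σ a b c d) : σ.support.card = 4 := by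
  have : σ.support = {a, b, c, d} := by
    ext x
    have := h.hab.ne; have := h.hbc.ne; have := h.hcd.ne; have := h.hda.ne
    have := h.fix x
    have := h.σa; have := h.σb; have := h.σc; have := h.σd
    simp only [Equiv.Perm.mem_support, Finset.mem_insert, Finset.mem_singleton]
    grind
  rw [this]
  have := h.hab.ne; have := h.hbc.ne; have := h.hcd.ne; have := h.hda.ne.symm
  simp [h.hac, h.hbd, *]

end IsQuad

theorem exists_isQuad {V : Type*} {G : SimpleGraph V} {a b c d : V} (hac : a ≠ c) (hbd : b ≠ d)
    (hab : G.Adj a b) (hbc : G.Adj b c) (hcd : G.Adj c d) (hda : G.Adj d a) :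
    IsQuad G (Equiv.swap a b * Equiv.swap b c * Equiv.swap c d) a b c d := by
  have := hab.ne; have := hbc.ne; have := hcd.ne; have := hda.ne
  refine ⟨hac, hbd, hab, hbc, hcd, hda, ?_, ?_, ?_, ?_, ?_⟩ <;>
    simp only [Equiv.Perm.mul_apply, Equiv.swap_apply_def] <;> grind

theorem IsQuad.sign {V : Type*} [Fintype V] {G : SimpleGraph V} {σ : Equiv.Perm V} {a b c d : V}
    (h : IsQuad G σ a b c d) : Equiv.Perm.sign σ = -1 := by
  rw [h.eq (exists_isQuad h.hac h.hbd h.hab h.hbc h.hcd h.hda)]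
  simp [Equiv.Perm.sign_mul, Equiv.Perm.sign_swap h.hab.ne, Equiv.Perm.sign_swap h.hbc.ne,
    Equiv.Perm.sign_swap h.hcd.ne]

section Walks

variable {V : Type*} {G : SimpleGraph V}

theorem isCycle_quad {a b c d : V} (hac : a ≠ c) (hbd : b ≠ d) (hab : G.Adj a b)
    (hbc : G.Adj b c) (hcd : G.Adj c d) (hda : G.Adj d a) :
    (Walk.cons hab (.cons hbc (.cons hcd (.cons hda .nil)))).IsCycle := by
  have := hab.ne; have := hbc.ne; have := hcd.ne; have := hda.ne
  simp [Walk.cons_isCycle_iff, Walk.cons_isPath_iff]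
  grind

theorem exists_of_isCycle_length_four {v : V} (w : G.Walk v v) (hw : w.IsCycle)
    (hlen : w.length = 4) :
    ∃ (a b c d : V) (hab : G.Adj a b) (hbc : G.Adj b c) (hcd : G.Adj c d) (hda : G.Adj d a),
      a ≠ c ∧ b ≠ d ∧
      w.toSubgraph = (Walk.cons hab (.cons hbc (.cons hcd (.cons hda .nil)))).toSubgraph := by
  match w, hlen with
  | .cons hab (.cons hbc (.cons hcd (.cons hda .nil))), _ =>
    refine ⟨_, _, _, _, hab, hbc, hcd, hda, ?_, ?_, rfl⟩ <;> rintro rfl <;>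
      simp [Walk.cons_isCycle_iff, Walk.cons_isPath_iff] at hw

theorem quad_toSubgraph_adj {a b c d : V} (hab : G.Adj a b)
    (hbc : G.Adj b c) (hcd : G.Adj c d) (hda : G.Adj d a) (u v : V) :
    (Walk.cons hab (.cons hbc (.cons hcd (.cons hda .nil)))).toSubgraph.Adj u v ↔
      (u = a ∧ v = b ∨ u = b ∧ v = a) ∨ (u = b ∧ v = c ∨ u = c ∧ v = b) ∨
      (u = c ∧ v = d ∨ u = d ∧ v = c) ∨ (u = d ∧ v = a ∨ u = a ∧ v = d) := by
  simp [Walk.toSubgraph]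
  grind

/-- The walk going back from `σ^k a` to `a` along the orbit of `a`. -/
def orbitWalk (σ : Equiv.Perm V) (a : V) (h : ∀ i, G.Adj (σ^[i + 1] a) (σ^[i] a)) :
    ∀ k, G.Walk (σ^[k] a) a
  | 0 => .nil
  | k + 1 => .cons (h k) (orbitWalk σ a h k)

variable {σ : Equiv.Perm V} {a : V} (h : ∀ i, G.Adj (σ^[i + 1] a) (σ^[i] a))

theorem length_orbitWalk (k : ℕ) : (orbitWalk σ a h k).length = k := by
  induction k with
  | zero => rfl
  | succ k ih => rw [orbitWalk, Walk.length_cons, ih]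

theorem mem_support_orbitWalk (k : ℕ) (x : V) :
    x ∈ (orbitWalk σ a h k).support ↔ ∃ i ≤ k, x = σ^[i] a := by
  induction k with
  | zero => simp [orbitWalk]
  | succ k ih =>
    rw [orbitWalk, Walk.support_cons, List.mem_cons, ih]
    constructor
    · rintro (hx | ⟨i, hi, hx⟩)
      · exact ⟨k + 1, le_rfl, hx⟩
      · exact ⟨i, by omega, hx⟩
    · rintro ⟨i, hi, hx⟩
      rcases Nat.lt_or_ge k i with hk | hk
      · left; rw [hx, show i = k + 1 by omega]
      · exact Or.inr ⟨i, hk, hx⟩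

theorem mem_edges_orbitWalk (k : ℕ) (e : Sym2 V) (he : e ∈ (orbitWalk σ a h k).edges) :
    ∃ i < k, e = s(σ^[i + 1] a, σ^[i] a) := by
  induction k with
  | zero => simp [orbitWalk] at he
  | succ k ih =>
    rw [orbitWalk, Walk.edges_cons, List.mem_cons] at he
    rcases he with he | he
    · exact ⟨k, by omega, he⟩
    · obtain ⟨i, hi, hx⟩ := ih he
      exact ⟨i, by omega, hx⟩

theorem isPath_orbitWalk (k : ℕ) (hk : k < Function.minimalPeriod σ a) :
    (orbitWalk σ a h k).IsPath := by
  induction k with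
  | zero => simp [orbitWalk]
  | succ k ih =>
    rw [orbitWalk, Walk.cons_isPath_iff, mem_support_orbitWalk]
    refine ⟨ih (by omega), ?_⟩
    rintro ⟨i, hi, hx⟩
    have := (Function.iterate_eq_iterate_iff_of_lt_minimalPeriod hk (by omega)).1 hx
    omega

end Walks

/-- In a graph whose cycles all have length 4 and are incident with every edge, an adapted
permutation that is not an involution is a single 4-cycle. -/
theorem exists_isQuad_of_isAdapted {V : Type*} [Fintype V] {G : SimpleGraph V}
    (hlen : ∀ (v : V) (c : G.Walk v v), c.IsCycle → c.length = 4)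
    (hdel : ∀ R : G.Subgraph, IsCycleSubgraph G R →
      ∀ x y : ↥(R.vertsᶜ), ¬ (G.induce (R.vertsᶜ)).Adj x y)
    {σ : Equiv.Perm V} (hσ : IsAdapted G σ) (h2 : σ ^ 2 ≠ 1) :
    ∃ a b c d, IsQuad G σ a b c d := by
  obtain ⟨a, ha⟩ : ∃ a, σ (σ a) ≠ a := by
    by_contra! hcon
    exact h2 (Equiv.ext fun x => by simpa [pow_two] using hcon x)
  have ha1 : σ a ≠ a := fun h => ha (by rw [h, h])
  have hne : ∀ i, σ (σ^[i] a) ≠ σ^[i] a := by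
    intro i hi
    rw [← Function.iterate_succ_apply' σ, Function.iterate_succ_apply σ] at hi
    exact ha1 (σ.injective.iterate i hi)
  have hadj : ∀ i, G.Adj (σ^[i + 1] a) (σ^[i] a) := fun i => by
    rw [Function.iterate_succ_apply']; exact hσ _ (hne i)
  have hper : a ∈ Function.periodicPts σ :=
    Function.mem_periodicPts.2 ⟨orderOf σ, orderOf_pos σ, by
      rw [Function.IsPeriodicPt, Function.IsFixedPt, Equiv.Perm.iterate_eq_pow,
        pow_orderOf_eq_one]; rfl⟩
  have hpos := Function.minimalPeriod_pos_of_mem_periodicPts hper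
  have hm0 := Function.iterate_minimalPeriod (f := σ) (x := a)
  obtain ⟨m, hm⟩ : ∃ m, Function.minimalPeriod σ a = m + 3 := by
    refine ⟨Function.minimalPeriod σ a - 3, ?_⟩
    have h1 : Function.minimalPeriod σ a ≠ 1 := fun h => by
      rw [h] at hm0; exact ha1 hm0
    have h2 : Function.minimalPeriod σ a ≠ 2 := fun h => by
      rw [h] at hm0; exact ha hm0
    omega
  have hinj : ∀ i j, i < m + 3 → j < m + 3 → σ^[i] a = σ^[j] a → i = j := fun i j hi hj h =>
    (Function.iterate_eq_iterate_iff_of_lt_minimalPeriod (hm ▸ hi) (hm ▸ hj)).1 h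
  rw [hm] at hm0
  have hclose : G.Adj a (σ^[m + 2] a) := by
    have := hadj (m + 2)
    rwa [hm0] at this
  have hcyc : (Walk.cons hclose (orbitWalk σ a hadj (m + 2))).IsCycle := by
    rw [Walk.cons_isCycle_iff]
    refine ⟨isPath_orbitWalk hadj _ (by omega), fun he => ?_⟩
    obtain ⟨i, hi, he⟩ := mem_edges_orbitWalk hadj _ _ he
    rw [Sym2.eq_iff] at he
    rcases he with ⟨h1, -⟩ | ⟨h1, h2⟩
    · have := hinj 0 (i + 1) (by omega) (by omega) h1
      omega
    · have h1 := hinj 0 i (by omega) (by omega) h1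
      have h2 := hinj (m + 2) (i + 1) (by omega) (by omega) h2
      omega
  have hm1 := hlen _ _ hcyc
  rw [Walk.length_cons, length_orbitWalk] at hm1
  obtain rfl : m = 1 := by omega
  have hσ4 : σ (σ (σ (σ a))) = a := hm0
  refine ⟨a, σ a, σ (σ a), σ (σ (σ a)), ⟨ha.symm, ?_, (hadj 0).symm, (hadj 1).symm, (hadj 2).symm,
    hclose.symm, rfl, rfl, rfl, hσ4, ?_⟩⟩
  · intro h
    exact ha (σ.injective h).symm
  · intro x hxa hxb hxc hxd
    by_contra hx
    have hverts : ∀ y, y ∈ (Walk.cons hclose (orbitWalk σ a hadj (1 + 2))).toSubgraph.verts →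
        y = a ∨ y = σ a ∨ y = σ (σ a) ∨ y = σ (σ (σ a)) := by
      intro y hy
      rw [Walk.mem_verts_toSubgraph, Walk.support_cons, List.mem_cons,
        mem_support_orbitWalk] at hy
      rcases hy with hy | ⟨i, hi, hy⟩
      · exact Or.inl hy
      · interval_cases i
        · exact Or.inl hy
        · exact Or.inr (Or.inl hy)
        · exact Or.inr (Or.inr (Or.inl hy))
        · exact Or.inr (Or.inr (Or.inr hy))
    refine hdel _ ⟨_, _, hcyc, rfl⟩ ⟨σ x, fun hy => ?_⟩ ⟨x, fun hy => ?_⟩ (hσ x hx)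
    · rcases hverts _ hy with h | h | h | h
      · exact hxd (σ.injective (h.trans hσ4.symm))
      · exact hxa (σ.injective h)
      · exact hxb (σ.injective h)
      · exact hxc (σ.injective h)
    · rcases hverts _ hy with h | h | h | h
      exacts [hxa h, hxb h, hxc h, hxd h]

/-- The subgraph `R` consists of the edges traversed by the permutation `σ`. -/
def Traces {V : Type*} {G : SimpleGraph V} (σ : Equiv.Perm V) (R : G.Subgraph) : Prop :=
  ∀ u v, R.Adj u v ↔ u ≠ v ∧ (σ u = v ∨ σ v = u)

theorem IsQuad.traces_iff {V : Type*} {G : SimpleGraph V} {σ : Equiv.Perm V} {a b c d : V}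
    (h : IsQuad G σ a b c d) {R : G.Subgraph} :
    Traces σ R ↔ ∀ u v, R.Adj u v ↔
      (Walk.cons h.hab (.cons h.hbc (.cons h.hcd (.cons h.hda .nil)))).toSubgraph.Adj u v := by
  refine forall_congr' fun u => forall_congr' fun v => ?_
  have key : (u ≠ v ∧ (σ u = v ∨ σ v = u)) ↔
    (Walk.cons h.hab (.cons h.hbc (.cons h.hcd (.cons h.hda .nil)))).toSubgraph.Adj u v := by
    rw [quad_toSubgraph_adj]
    have := h.hab.ne; have := h.hbc.ne; have := h.hcd.ne; have := h.hda.ne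
    have := h.hac; have := h.hbd
    have hmove : ∀ x, x = a ∨ x = b ∨ x = c ∨ x = d ∨ σ x = x := fun x => by
      have := h.fix x
      tauto
    have hinj := σ.injective.eq_iff (a := u) (b := v)
    have := h.σa; have := h.σb; have := h.σc; have := h.σd
    rcases hmove u with hu | hu | hu | hu | hu <;>
      rcases hmove v with hv | hv | hv | hv | hv <;> clear hmove <;> grind
  rw [key]

theorem isQuad_or_isQuad_of_traces {V : Type*} {G : SimpleGraph V} {σ : Equiv.Perm V}
    {a b c d : V} (hac : a ≠ c) (hbd : b ≠ d) (hab : G.Adj a b) (hbc : G.Adj b c)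
    (hcd : G.Adj c d) (hda : G.Adj d a)
    (h : Traces σ (Walk.cons hab (.cons hbc (.cons hcd (.cons hda .nil)))).toSubgraph) :
    IsQuad G σ a b c d ∨ IsQuad G σ a d c b := by
  simp only [Traces, quad_toSubgraph_adj] at h
  have h1 : σ a = b ∨ σ b = a := ((h a b).1 (by simp)).2
  have h2 : σ b = c ∨ σ c = b := ((h b c).1 (by simp)).2
  have h3 : σ c = d ∨ σ d = c := ((h c d).1 (by simp)).2
  have h4 : σ d = a ∨ σ a = d := ((h d a).1 (by simp)).2
  have hac' : σ a ≠ σ c := σ.injective.ne hac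
  have hbd' : σ b ≠ σ d := σ.injective.ne hbd
  have hfix : ∀ x, x ≠ a → x ≠ b → x ≠ c → x ≠ d → σ x = x := by
    intro x ha hb hc hd
    by_contra hx
    have := (h x (σ x)).2 ⟨Ne.symm hx, Or.inl rfl⟩
    tauto
  rcases h1 with h1 | h1
  · left
    have h2 : σ b = c := h2.resolve_right fun h => hac' (h1.trans h.symm)
    have h3 : σ c = d := h3.resolve_right fun h => hbd' (h2.trans h.symm)
    have h4 : σ d = a := h4.resolve_right fun h => hac' (h.trans h3.symm)
    exact ⟨hac, hbd, hab, hbc, hcd, hda, h1, h2, h3, h4, hfix⟩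
  · right
    have h4 : σ a = d := h4.resolve_left fun h => hbd' (h1.trans h.symm)
    have h3 : σ d = c := h3.resolve_left fun h => hac' (h4.trans h.symm)
    have h2 : σ c = b := h2.resolve_left fun h => hbd' (h.trans h3.symm)
    exact ⟨hac, hbd.symm, hda.symm, hcd.symm, hbc.symm, hab.symm, h4, h3, h2, h1,
      fun x ha hd hc hb => hfix x ha hb hc hd⟩

theorem IsCycleSubgraph.ext {V : Type*} {G : SimpleGraph V} {R S : G.Subgraph}
    (hR : IsCycleSubgraph G R) (hS : IsCycleSubgraph G S) (h : ∀ u v, R.Adj u v ↔ S.Adj u v) :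
    R = S := by
  have hv : ∀ T : G.Subgraph, IsCycleSubgraph G T → T.verts = T.support := by
    rintro T ⟨v, c, hc, rfl⟩
    refine Set.Subset.antisymm (fun x hx => ?_) (Subgraph.support_subset_verts _)
    rw [Walk.mem_verts_toSubgraph] at hx
    have hdeg := hc.ncard_neighborSet_toSubgraph_eq_two hx
    obtain ⟨y, hy⟩ := Set.nonempty_of_ncard_ne_zero (hdeg.trans_ne two_ne_zero)
    exact ⟨y, hy⟩
  refine Subgraph.ext ?_ (by ext u v; exact h u v)
  rw [hv R hR, hv S hS]
  ext x
  simp [Subgraph.mem_support, h]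

theorem card_filter_isAdapted {V : Type*} [Fintype V] {G : SimpleGraph V}
    (hlen : ∀ (v : V) (c : G.Walk v v), c.IsCycle → c.length = 4)
    (hdel : ∀ R : G.Subgraph, IsCycleSubgraph G R →
      ∀ x y : ↥(R.vertsᶜ), ¬ (G.induce (R.vertsᶜ)).Adj x y) :
    (Finset.univ.filter fun σ : Equiv.Perm V => IsAdapted G σ ∧ σ ^ 2 ≠ 1).card =
      2 * Set.ncard {R : G.Subgraph | IsCycleSubgraph G R} := by
  have hcard := Finset.card_mul_eq_card_mul (Traces (G := G))
    (s := Finset.univ.filter fun σ : Equiv.Perm V => IsAdapted G σ ∧ σ ^ 2 ≠ 1)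
    (t := Finset.univ.filter fun R : G.Subgraph => IsCycleSubgraph G R) (m := 1) (n := 2) ?_ ?_
  · rw [Set.ncard_eq_toFinset_card', mul_comm 2, ← mul_one (Finset.card _), hcard]
    congr 2
    ext; simp
  · intro σ hσ
    obtain ⟨hσ, h2⟩ := (Finset.mem_filter.1 hσ).2
    obtain ⟨a, b, c, d, h⟩ := exists_isQuad_of_isAdapted hlen hdel hσ h2
    have hcyc : IsCycleSubgraph G _ := ⟨_, _, isCycle_quad h.hac h.hbd h.hab h.hbc h.hcd h.hda, rfl⟩
    rw [Finset.card_eq_one]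
    refine ⟨_, Finset.eq_singleton_iff_unique_mem.2 ⟨Finset.mem_filter.2
      ⟨Finset.mem_filter.2 ⟨Finset.mem_univ _, hcyc⟩, h.traces_iff.2 fun _ _ => Iff.rfl⟩, ?_⟩⟩
    intro S hS
    obtain ⟨hS, hσS⟩ := Finset.mem_filter.1 hS
    exact IsCycleSubgraph.ext (Finset.mem_filter.1 hS).2 hcyc (h.traces_iff.1 hσS)
  · intro R hR
    obtain ⟨v, w, hw, rfl⟩ := (Finset.mem_filter.1 hR).2
    obtain ⟨a, b, c, d, hab, hbc, hcd, hda, hac, hbd, hR⟩ :=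
      exists_of_isCycle_length_four w hw (hlen v w hw)
    rw [hR]
    obtain ⟨τ, hτ⟩ : ∃ τ, IsQuad G τ a b c d := ⟨_, exists_isQuad hac hbd hab hbc hcd hda⟩
    have hinv : τ ≠ τ⁻¹ := fun h => hτ.sq_ne_one (by rw [pow_two]; nth_rw 2 [h]; simp)
    have hfiber : (Finset.univ.filter fun σ : Equiv.Perm V =>
        IsAdapted G σ ∧ σ ^ 2 ≠ 1).bipartiteBelow Traces
          (Walk.cons hab (.cons hbc (.cons hcd (.cons hda .nil)))).toSubgraph = {τ, τ⁻¹} := ?_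
    · rw [hfiber, Finset.card_pair hinv]
    ext σ
    simp only [Finset.bipartiteBelow, Finset.mem_filter, Finset.mem_univ, true_and,
      Finset.mem_insert, Finset.mem_singleton]
    constructor
    · rintro ⟨-, ht⟩
      have key := isQuad_or_isQuad_of_traces hac hbd hab hbc hcd hda ht
      rcases key with h | h
      · exact Or.inl (h.eq hτ)
      · exact Or.inr (h.eq hτ.symm)
    · rintro (rfl | rfl)
      · exact ⟨⟨hτ.isAdapted, hτ.sq_ne_one⟩, hτ.traces_iff.2 fun _ _ => Iff.rfl⟩
      · refine ⟨⟨hτ.symm.isAdapted, hτ.symm.sq_ne_one⟩, hτ.symm.traces_iff.2 fun u v => ?_⟩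
        rw [quad_toSubgraph_adj, quad_toSubgraph_adj]
        grind

/-- Let `G` be a bipartite graph on `n` vertices whose cycles are exactly `l`
distinct 4-cycles (`l > 0`), with no cycles of any other length, such that deleting the vertices
of any 4-cycle leaves an edgeless graph. Then `f(G,x) = π(G,x) - φ_p(G,x) = 4l·x^{n-4}`. -/
theorem stmt_12 {V : Type*} [Fintype V] (G : SimpleGraph V) (hbip : G.Colorable 2)
    (l : ℕ) (hl : 0 < l)
    (hnum : Set.ncard {R : G.Subgraph | IsCycleSubgraph G R} = l)
    (hlen : ∀ (v : V) (c : G.Walk v v), c.IsCycle → c.length = 4)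
    (hdel : ∀ R : G.Subgraph, IsCycleSubgraph G R →
      ∀ x y : ↥(R.vertsᶜ), ¬ (G.induce (R.vertsᶜ)).Adj x y) :
    permPolyG ℝ G - phiP G = C (4 * (l : ℝ)) * X ^ (Fintype.card V - 4) := by
  have hterm : ∀ σ : Equiv.Perm V,
      ∏ i, (adjMat ℝ G).charmatrix (σ i) i - evenTwist (Fintype.card V)
        (Equiv.Perm.sign σ • ∏ i, (adjMat ℝ G).charmatrix (σ i) i) =
      if IsAdapted G σ ∧ σ ^ 2 ≠ 1 then C 2 * X ^ (Fintype.card V - 4) else 0 := by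
    intro σ
    rw [prod_charmatrix_adjMat]
    by_cases hσ : IsAdapted G σ
    swap
    · simp [hσ]
    have hsmul : ∀ (s : ℤˣ) (r : ℝ) (p : ℝ[X]), s • (C r * p) = C (((s : ℤ) : ℝ) * r) * p := by
      intro s r p
      rw [Units.smul_def, zsmul_eq_mul, C_mul, mul_assoc]
      simp
    have hle : σ.support.card ≤ Fintype.card V := Finset.card_le_univ _
    by_cases h2 : σ ^ 2 = 1
    · have he := even_card_support_of_sq_eq_one h2
      rw [if_pos hσ, if_neg (by tauto), hsmul, evenTwist_C_mul_X_pow hle he,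
        sign_of_sq_eq_one h2, he.neg_one_pow, mul_one, sub_eq_zero]
      congr 2
      push_cast
      rw [← mul_pow]
      simp
    · obtain ⟨a, b, c, d, h⟩ := exists_isQuad_of_isAdapted hlen hdel hσ h2
      rw [h.card_support] at hle
      rw [if_pos hσ, if_pos ⟨hσ, h2⟩, hsmul, h.card_support, h.sign,
        evenTwist_C_mul_X_pow hle (by decide), ← sub_mul, ← C_sub]
      norm_num
  rw [phiP_eq_evenTwist, permPolyG, charPolyG, Matrix.charpoly, Matrix.permanent,
    Matrix.det_apply, map_sum, ← Finset.sum_sub_distrib, Finset.sum_congr rfl fun σ _ => hterm σ,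
    ← Finset.sum_filter, Finset.sum_const, card_filter_isAdapted hlen hdel, hnum, nsmul_eq_mul,
    ← mul_assoc]
  congr 1
  simp only [Nat.cast_mul, C_mul, map_natCast]
  rw [show (4 : ℝ) = 2 * 2 by norm_num, C_mul]
  push_cast
  simp only [map_ofNat]
  ring

end
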